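/- Let Σ be a topologically transitive countable Markov shift and let φ : Σ → ℝ be a summable potential with Σ_{n≥1} Var_n(φ) < ∞ and P_G(φ) < ∞. Then lim_{t→∞} P_G(tφ)/t = α(φ). -/

import Mathlib

open MeasureTheory Filter Topology BoundedContinuousFunction
open scoped ENNReal NNReal

noncomputable section

/-! ## Countable Markov shifts (one-sided) -/

/-- The one-sided countable Markov shift over the alphabet `ℕ` determined by the
transition matrix (relation) `A`. -/
structure MShift (A : ℕ → ℕ → Prop) : Type where
  seq : ℕ → ℕ
  adm : ∀ i : ℕ, A (seq i) (seq (i + 1))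

/-- The topology generated by the cylinders: the topology induced from the product
topology on `ℕ → ℕ` (with `ℕ` discrete). -/
instance (A : ℕ → ℕ → Prop) : TopologicalSpace (MShift A) :=
  TopologicalSpace.induced MShift.seq inferInstance

/-- The Borel σ-algebra on the shift space. -/
instance (A : ℕ → ℕ → Prop) : MeasurableSpace (MShift A) := borel (MShift A)

instance (A : ℕ → ℕ → Prop) : BorelSpace (MShift A) := ⟨rfl⟩

/-- The shift map `σ`. -/
def shiftMap (A : ℕ → ℕ → Prop) (x : MShift A) : MShift A :=
  ⟨fun i => x.seq (i + 1), fun i => x.adm (i + 1)⟩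

/-- No row and no column of the transition matrix is identically zero. -/
def NoZeroRC (A : ℕ → ℕ → Prop) : Prop :=
  ∀ i : ℕ, (∃ j, A i j) ∧ (∃ j, A j i)

/-- The cylinder `[x₀ … x_{n-1}]` determined by a finite word `w`. -/
def cylSet (A : ℕ → ℕ → Prop) (w : List ℕ) : Set (MShift A) :=
  {x | ∀ i < w.length, x.seq i = w.getD i 0}

/-- A path: an admissible word `x₀ … xₙ` with `n ≥ 1` and nonempty cylinder. -/
def IsPath (A : ℕ → ℕ → Prop) (w : List ℕ) : Prop :=
  2 ≤ w.length ∧ w.Chain' A ∧ (cylSet A w).Nonempty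

/-- The length `l(γ) = n` of a path `γ = x₀ … xₙ` (represented as a list of `n+1` symbols). -/
def pathLen (w : List ℕ) : ℕ := w.length - 1

/-- The weight `φ(γ) = Σ_{k=0}^{n-1} ψ(x_k x_{k+1})` of a word under a Markov
potential determined by `ψ : ℕ → ℕ → ℝ`. -/
def pathWt (ψ : ℕ → ℕ → ℝ) : List ℕ → ℝ
  | [] => 0
  | [_] => 0
  | a :: b :: l => ψ a b + pathWt ψ (b :: l)

/-- Topological transitivity: any two symbols are connected by a path. -/
def TopTrans (A : ℕ → ℕ → Prop) : Prop :=
  ∀ a b : ℕ, ∃ w : List ℕ, IsPath A w ∧ w.headI = a ∧ w.getLastD 0 = b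

/-- The Birkhoff sum `Sₙφ`. -/
def birkhoff (A : ℕ → ℕ → Prop) (φ : MShift A → ℝ) (n : ℕ) (x : MShift A) : ℝ :=
  ∑ i ∈ Finset.range n, φ ((shiftMap A)^[i] x)

/-- The Gurevich partition function `Zₙ(φ, a)`. -/
def Zpart (A : ℕ → ℕ → Prop) (φ : MShift A → ℝ) (n : ℕ) (a : ℕ) : ℝ≥0∞ :=
  ∑' x : {x : MShift A // (shiftMap A)^[n] x = x ∧ x.seq 0 = a},
    ENNReal.ofReal (Real.exp (birkhoff A φ n x.1))

/-- `Zₙ*(φ, a)`: the partition function restricted to first returns to `a`. -/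
def ZpartStar (A : ℕ → ℕ → Prop) (φ : MShift A → ℝ) (n : ℕ) (a : ℕ) : ℝ≥0∞ :=
  ∑' x : {x : MShift A // (shiftMap A)^[n] x = x ∧ x.seq 0 = a ∧
      ∀ k, 0 < k → k < n → x.seq k ≠ a},
    ENNReal.ofReal (Real.exp (birkhoff A φ n x.1))

/-- The Gurevich pressure `P_G(φ) = limsup (1/n) log Zₙ(φ, a)` (at the symbol `a`),
as an extended real number. -/
def PGur (A : ℕ → ℕ → Prop) (φ : MShift A → ℝ) (a : ℕ) : EReal :=
  Filter.atTop.limsup fun n : ℕ => (((n : ℝ)⁻¹ : ℝ) : EReal) * ENNReal.log (Zpart A φ n a)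

/-- `p` is the (common, symbol-independent) value of the Gurevich pressure of `φ`. -/
def IsPG (A : ℕ → ℕ → Prop) (φ : MShift A → ℝ) (p : EReal) : Prop :=
  ∀ a : ℕ, (∃ x : MShift A, x.seq 0 = a) → PGur A φ a = p

/-- `φ` is a summable potential: `Σᵢ exp (sup φ|_[i]) < ∞`. -/
def SummablePot (A : ℕ → ℕ → Prop) (φ : MShift A → ℝ) : Prop :=
  ∃ s : ℕ → ℝ, Summable (fun i => Real.exp (s i)) ∧
    ∀ (i : ℕ) (x : MShift A), x.seq 0 = i → φ x ≤ s i

/-- `V` is a bound for the `n`-th variation `Varₙ(φ)`. -/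
def VarBdd (A : ℕ → ℕ → Prop) (φ : MShift A → ℝ) (n : ℕ) (V : ℝ) : Prop :=
  ∀ x y : MShift A, (∀ i < n, x.seq i = y.seq i) → |φ x - φ y| ≤ V

/-- σ-invariance of a Borel measure on the shift space. -/
def ShiftInv (A : ℕ → ℕ → Prop) (μ : Measure (MShift A)) : Prop :=
  ∀ s : Set (MShift A), MeasurableSet s → μ (shiftMap A ⁻¹' s) = μ s

/-- The maximal ergodic average `α(φ)`. -/
def alphaSup (A : ℕ → ℕ → Prop) (φ : MShift A → ℝ) : ℝ :=
  sSup {r : ℝ | ∃ μ : Measure (MShift A), IsProbabilityMeasure μ ∧ ShiftInv A μ ∧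
    Integrable φ μ ∧ r = ∫ x, φ x ∂μ}

/-- `μ` is the Gurevich–Markov (stationary Markov equilibrium) measure associated to the
Markov potential `ψ` with pressure `p`. -/
structure IsGM (A : ℕ → ℕ → Prop) (ψ : ℕ → ℕ → ℝ) (p : ℝ) (μ : Measure (MShift A)) : Prop where
  prob : IsProbabilityMeasure μ
  inv : ShiftInv A μ
  eigen : ∃ h hT : ℕ → ℝ, (∀ a, 0 < h a) ∧ (∀ a, 0 < hT a) ∧
    (∀ j : ℕ, (∑' a : {a : ℕ // A a j}, ENNReal.ofReal (Real.exp (ψ a.1 j) * h a.1))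
        = ENNReal.ofReal (Real.exp p * h j)) ∧
    (∀ j : ℕ, (∑' b : {b : ℕ // A j b}, ENNReal.ofReal (Real.exp (ψ j b.1) * hT b.1))
        = ENNReal.ofReal (Real.exp p * hT j)) ∧
    (∑' a : ℕ, ENNReal.ofReal (h a * hT a)) = 1 ∧
    (∀ w : List ℕ, w ≠ [] → w.Chain' A → (cylSet A w).Nonempty →
      μ (cylSet A w) = ENNReal.ofReal
        (h w.headI * hT (w.getLastD 0) * Real.exp (pathWt ψ w - (pathLen w : ℝ) * p)))

/-! ## Loops and main paths (one-sided) -/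

/-- A loop at `a`. -/
def IsLoopAt (A : ℕ → ℕ → Prop) (a : ℕ) (w : List ℕ) : Prop :=
  IsPath A w ∧ w.headI = a ∧ w.getLastD 0 = a

/-- The word `w` passes through `b`, i.e. some intermediate symbol of `w` equals `b`. -/
def PassesThrough (w : List ℕ) (b : ℕ) : Prop :=
  ∃ m, 0 < m ∧ m < w.length - 1 ∧ w.getD m 0 = b

/-- No intermediate symbol of `w` lies in `J`. -/
def AvoidsIn (w : List ℕ) (J : Finset ℕ) : Prop :=
  ∀ m, 0 < m → m < w.length - 1 → w.getD m 0 ∉ J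

/-- A first-return loop at `c`: a loop at `c` with no intermediate occurrence of `c`. -/
def FirstRetLoop (A : ℕ → ℕ → Prop) (c : ℕ) (w : List ℕ) : Prop :=
  IsPath A w ∧ w.headI = c ∧ w.getLastD 0 = c ∧
    ∀ m, 0 < m → m < w.length - 1 → w.getD m 0 ≠ c

/-- A main path from `i` to `j` (relative to the pair of symbols `{a, b}`): a path from
`i` to `j` with no intermediate occurrence of `a` nor of `b`. -/
def MainPath (A : ℕ → ℕ → Prop) (a b i j : ℕ) (w : List ℕ) : Prop :=
  IsPath A w ∧ w.headI = i ∧ w.getLastD 0 = j ∧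
    ∀ m, 0 < m → m < w.length - 1 → w.getD m 0 ≠ a ∧ w.getD m 0 ≠ b

/-- `p_{ij}^t`: the sum of `exp(ψ(γ) − l(γ)·p)` over all main paths from `i` to `j`. -/
def pSum (A : ℕ → ℕ → Prop) (ψ : ℕ → ℕ → ℝ) (p : ℝ) (a b i j : ℕ) : ℝ≥0∞ :=
  ∑' w : {w : List ℕ // MainPath A a b i j w},
    ENNReal.ofReal (Real.exp (pathWt ψ w.1 - (pathLen w.1 : ℝ) * p))

/-- `r_{ij}^t`: as `pSum`, restricted to main paths all of whose symbols lie in `S'`. -/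
def rSum (A : ℕ → ℕ → Prop) (ψ : ℕ → ℕ → ℝ) (p : ℝ) (a b i j : ℕ) (S' : Finset ℕ) : ℝ≥0∞ :=
  ∑' w : {w : List ℕ // MainPath A a b i j w ∧ ∀ m < w.length, w.getD m 0 ∈ S'},
    ENNReal.ofReal (Real.exp (pathWt ψ w.1 - (pathLen w.1 : ℝ) * p))

/-- Number of intermediate occurrences of symbols of `I` in the word `w`. -/
def interCount (I : Finset ℕ) (w : List ℕ) : ℕ :=
  ((w.drop 1).take (w.length - 2)).countP (fun s => decide (s ∈ I))

/-- `p_{ij}^t(n)`: as `pSum`, restricted to main paths with exactly `n` intermediate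
occurrences of symbols of `I`. -/
def pSumN (A : ℕ → ℕ → Prop) (ψ : ℕ → ℕ → ℝ) (p : ℝ) (a b i j : ℕ)
    (I : Finset ℕ) (n : ℕ) : ℝ≥0∞ :=
  ∑' w : {w : List ℕ // MainPath A a b i j w ∧ interCount I w = n},
    ENNReal.ofReal (Real.exp (pathWt ψ w.1 - (pathLen w.1 : ℝ) * p))

/-- An `I`-free path from `i` to `j`: a path from `i` to `j` with no intermediate
symbol in `I`. -/
def IFree (A : ℕ → ℕ → Prop) (I : Finset ℕ) (i j : ℕ) (w : List ℕ) : Prop :=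
  IsPath A w ∧ w.headI = i ∧ w.getLastD 0 = j ∧
    ∀ m, 0 < m → m < w.length - 1 → w.getD m 0 ∉ I

/-! ## Two-sided countable Markov shifts -/

/-- The two-sided countable Markov shift determined by `A`. -/
structure MShift2 (A : ℕ → ℕ → Prop) : Type where
  seq : ℤ → ℕ
  adm : ∀ i : ℤ, A (seq i) (seq (i + 1))

instance (A : ℕ → ℕ → Prop) : TopologicalSpace (MShift2 A) :=
  TopologicalSpace.induced MShift2.seq inferInstance

instance (A : ℕ → ℕ → Prop) : MeasurableSpace (MShift2 A) := borel (MShift2 A)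

instance (A : ℕ → ℕ → Prop) : BorelSpace (MShift2 A) := ⟨rfl⟩

/-- The (invertible) shift map on the two-sided shift. -/
def shiftMap2 (A : ℕ → ℕ → Prop) (x : MShift2 A) : MShift2 A :=
  ⟨fun i => x.seq (i + 1), fun i => x.adm (i + 1)⟩

/-- Cylinder based at coordinate 0 in the two-sided shift. -/
def cylSet2 (A : ℕ → ℕ → Prop) (w : List ℕ) : Set (MShift2 A) :=
  {x | ∀ i < w.length, x.seq (i : ℤ) = w.getD i 0}

/-- A path in the two-sided shift: an admissible word `x₀ … xₙ`, `n ≥ 1`. -/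
def IsPath2 (A : ℕ → ℕ → Prop) (w : List ℕ) : Prop :=
  2 ≤ w.length ∧ w.Chain' A

/-- σ-invariance of a Borel measure on the two-sided shift. -/
def ShiftInv2 (A : ℕ → ℕ → Prop) (μ : Measure (MShift2 A)) : Prop :=
  ∀ s : Set (MShift2 A), MeasurableSet s → μ (shiftMap2 A ⁻¹' s) = μ s

/-- Main path from `i` to `j` relative to `{a, b}` in the two-sided shift. -/
def MainPath2 (A : ℕ → ℕ → Prop) (a b i j : ℕ) (w : List ℕ) : Prop :=
  IsPath2 A w ∧ w.headI = i ∧ w.getLastD 0 = j ∧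
    ∀ m, 0 < m → m < w.length - 1 → w.getD m 0 ≠ a ∧ w.getD m 0 ≠ b

/-- `p_{ij}`: the sum of `exp(ψ(γ) − l(γ)·P)` over all main paths from `i` to `j`
in the two-sided shift. -/
def pSum2 (A : ℕ → ℕ → Prop) (ψ : ℕ → ℕ → ℝ) (P : ℝ) (a b i j : ℕ) : ℝ≥0∞ :=
  ∑' w : {w : List ℕ // MainPath2 A a b i j w},
    ENNReal.ofReal (Real.exp (pathWt ψ w.1 - (pathLen w.1 : ℝ) * P))

/-! ## The Ruelle operator and the renewal shift -/

/-- The Ruelle (transfer) operator acting on nonnegative measurable functions. -/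
def ruelleOp (A : ℕ → ℕ → Prop) (ψ : MShift A → ℝ) (f : MShift A → ℝ≥0∞)
    (x : MShift A) : ℝ≥0∞ :=
  ∑' y : {y : MShift A // shiftMap A y = x}, ENNReal.ofReal (Real.exp (ψ y.1)) * f y.1

/-- The transition matrix of the renewal shift: `A(1,1) = A(1,i) = A(i, i-1) = 1` for
every `i > 1`, all other entries `0` (alphabet `{1, 2, …}`). -/
def renewalA : ℕ → ℕ → Prop := fun i j => (i = 1 ∧ 1 ≤ j) ∨ (2 ≤ i ∧ j = i - 1)

/-- The potential `φ(x) = -x₀` on the renewal shift. -/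
def phiRen : MShift renewalA → ℝ := fun x => -(x.seq 0 : ℝ)

/-- The potential `φ(x) = x₀ - x₁` on the renewal shift. -/
def phiRen2 : MShift renewalA → ℝ := fun x => (x.seq 0 : ℝ) - (x.seq 1 : ℝ)

/-- The fixed point `1̄ = (1,1,1,…)` of the renewal shift. -/
def onebar : MShift renewalA := ⟨fun _ => 1, fun _ => Or.inl ⟨rfl, le_refl 1⟩⟩

end

namespace MShift

variable {A : ℕ → ℕ → Prop}

@[ext]
theorem ext' {x y : MShift A} (h : ∀ i, x.seq i = y.seq i) : x = y := by
  cases x; cases y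
  simp only [MShift.mk.injEq]
  exact funext h

theorem seq_iterate (n : ℕ) (x : MShift A) (k : ℕ) :
    ((shiftMap A)^[n] x).seq k = x.seq (k + n) := by
  induction n generalizing x with
  | zero => rfl
  | succ n ih =>
    rw [Function.iterate_succ_apply, ih]
    change x.seq (k + n + 1) = _
    rw [add_assoc]

theorem seq_injective : Function.Injective (MShift.seq : MShift A → ℕ → ℕ) :=
  fun _ _ h => ext' fun i => congrFun h i

theorem continuous_seq : Continuous (MShift.seq : MShift A → ℕ → ℕ) :=
  continuous_induced_dom

instance : T2Space (MShift A) :=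
  T2Space.of_injective_continuous seq_injective continuous_seq

theorem continuous_shiftMap : Continuous (shiftMap A) := by
  refine continuous_induced_rng.2 (continuous_pi fun i => ?_)
  exact (continuous_apply (i + 1)).comp continuous_seq

/-- Follow `x` for `l` steps, then `z`. -/
def concat (x : MShift A) (l : ℕ) (z : MShift A) (h : x.seq l = z.seq 0) : MShift A where
  seq k := if k < l then x.seq k else z.seq (k - l)
  adm i := by
    rcases lt_trichotomy (i + 1) l with hi | hi | hi
    · simpa [hi, Nat.lt_of_succ_lt hi] using x.adm i
    · subst hi
      simpa [← h] using x.adm i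
    · have h1 : ¬ i < l := by omega
      have h2 : ¬ i + 1 < l := by omega
      have h3 : i + 1 - l = i - l + 1 := by omega
      simpa only [h1, h2, if_false, h3] using z.adm (i - l)

theorem concat_seq_of_lt {x z : MShift A} {l : ℕ} (h : x.seq l = z.seq 0) {k : ℕ} (hk : k < l) :
    (concat x l z h).seq k = x.seq k := if_pos hk

theorem iterate_concat {x z : MShift A} {l : ℕ} (h : x.seq l = z.seq 0) :
    (shiftMap A)^[l] (concat x l z h) = z := by
  ext k
  rw [seq_iterate]
  simp [concat]

/-- The periodic point obtained by repeating a loop of length `m`. -/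
def closeUp (x : MShift A) (m : ℕ) (hm : 0 < m) (h : x.seq m = x.seq 0) : MShift A where
  seq k := x.seq (k % m)
  adm i := by
    have hlt := Nat.mod_lt i hm
    rcases Nat.lt_or_ge (i % m + 1) m with hi | hi
    · have : (i + 1) % m = i % m + 1 := by
        rw [Nat.add_mod, Nat.mod_eq_of_lt (show 1 < m by omega), Nat.mod_eq_of_lt hi]
      rw [this]
      exact x.adm _
    · have h1 : i % m + 1 = m := by omega
      have h2 : (i + 1) % m = 0 := by
        rw [← Nat.mod_add_mod, h1, Nat.mod_self]
      rw [h2, ← h]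
      conv_rhs => rw [← h1]
      exact x.adm _

theorem iterate_closeUp (x : MShift A) (m : ℕ) (hm : 0 < m) (h : x.seq m = x.seq 0) :
    (shiftMap A)^[m] (closeUp x m hm h) = closeUp x m hm h := by
  ext k
  rw [seq_iterate]
  simp [closeUp]

theorem closeUp_seq_of_lt (x : MShift A) (m : ℕ) (hm : 0 < m) (h : x.seq m = x.seq 0)
    {k : ℕ} (hk : k < m) : (closeUp x m hm h).seq k = x.seq k := by
  simp [closeUp, Nat.mod_eq_of_lt hk]

end MShift

section BirkhoffSums

variable {A : ℕ → ℕ → Prop} {φ : MShift A → ℝ}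

theorem birkhoff_add (φ : MShift A → ℝ) (m n : ℕ) (x : MShift A) :
    birkhoff A φ (m + n) x = birkhoff A φ m x + birkhoff A φ n ((shiftMap A)^[m] x) :=
  birkhoffSum_add _ _ _ _ _

theorem birkhoff_one (φ : MShift A → ℝ) (x : MShift A) : birkhoff A φ 1 x = φ x := by
  simp [birkhoff]

theorem birkhoff_const_mul (φ : MShift A → ℝ) (t : ℝ) (n : ℕ) (x : MShift A) :
    birkhoff A (fun x => t * φ x) n x = t * birkhoff A φ n x := by
  simp [birkhoff, Finset.mul_sum]

theorem birkhoff_sub_const (φ : MShift A → ℝ) (c : ℝ) (n : ℕ) (x : MShift A) :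
    birkhoff A (fun x => φ x - c) n x = birkhoff A φ n x - n * c := by
  simp [birkhoff]

theorem birkhoff_mul_of_periodic {m : ℕ} {y : MShift A} (hy : (shiftMap A)^[m] y = y) (k : ℕ) :
    birkhoff A φ (m * k) y = k * birkhoff A φ m y := by
  induction k with
  | zero => simp [birkhoff]
  | succ k ih =>
    rw [Nat.mul_succ, add_comm, birkhoff_add, hy, ih]
    push_cast
    ring

/-- Bounded distortion of Birkhoff sums. -/
theorem abs_birkhoff_sub_le {V : ℕ → ℝ} (hVsum : Summable V)
    (hV : ∀ n : ℕ, 1 ≤ n → VarBdd A φ n (V n)) {m : ℕ} {x y : MShift A}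
    (h : ∀ i < m, x.seq i = y.seq i) :
    |birkhoff A φ m x - birkhoff A φ m y| ≤ ∑' n, |V n| := by
  unfold birkhoff
  rw [← Finset.sum_sub_distrib]
  calc _ ≤ ∑ k ∈ Finset.range m, |φ ((shiftMap A)^[k] x) - φ ((shiftMap A)^[k] y)| :=
        Finset.abs_sum_le_sum_abs _ _
    _ ≤ ∑ k ∈ Finset.range m, |V (m - 1 - k + 1)| := by
        refine Finset.sum_le_sum fun k hk => ?_
        rw [Finset.mem_range] at hk
        refine (hV (m - 1 - k + 1) (by omega) _ _ fun i hi => ?_).trans (le_abs_self _)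
        rw [MShift.seq_iterate, MShift.seq_iterate]
        exact h _ (by omega)
    _ = ∑ k ∈ Finset.range m, |V (k + 1)| :=
        Finset.sum_range_reflect (fun k => |V (k + 1)|) m
    _ ≤ ∑' n, |V (n + 1)| :=
        ((summable_nat_add_iff 1).2 hVsum.abs).sum_le_tsum _ fun _ _ => abs_nonneg _
    _ ≤ ∑' n, |V n| := by
        rw [hVsum.abs.tsum_eq_zero_add]
        linarith [abs_nonneg (V 0)]

/-- If loops have Birkhoff sums at most `C` and the potential is nonpositive on cylinders outside
a finite set `F` of symbols, then all Birkhoff sums are uniformly bounded above. -/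
theorem birkhoff_le_card_mul {C M : ℝ} (hC : 0 ≤ C) (hM : 0 ≤ M) (hφM : ∀ x, φ x ≤ M)
    (hloop : ∀ (m : ℕ) (x : MShift A), 0 < m → x.seq m = x.seq 0 → birkhoff A φ m x ≤ C)
    (n : ℕ) (F : Finset ℕ) (x : MShift A)
    (hF : ∀ k < n, x.seq k ∉ F → φ ((shiftMap A)^[k] x) ≤ 0) :
    birkhoff A φ n x ≤ F.card * (C + M) := by
  induction n using Nat.strong_induction_on generalizing F x with
  | _ n ih =>
  rcases Nat.eq_zero_or_pos n with rfl | hn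
  · simp only [birkhoff, Finset.range_zero, Finset.sum_empty]
    positivity
  by_cases h0 : x.seq 0 ∈ F
  · obtain ⟨j, ⟨hjn, hj0⟩, hjmax⟩ : ∃ j, (j < n ∧ x.seq j = x.seq 0) ∧
        ∀ k, (k < n ∧ x.seq k = x.seq 0) → k ≤ j := by
      refine ⟨Nat.findGreatest (fun k => k < n ∧ x.seq k = x.seq 0) n,
        Nat.findGreatest_spec (P := fun k => k < n ∧ x.seq k = x.seq 0) (Nat.zero_le n) ⟨hn, rfl⟩,
        fun k hk => Nat.le_findGreatest hk.1.le hk⟩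
    have hSj : birkhoff A φ j x ≤ C := by
      rcases Nat.eq_zero_or_pos j with rfl | hj
      · simpa [birkhoff] using hC
      · exact hloop j x hj hj0
    have hrest : birkhoff A φ (n - (j + 1)) ((shiftMap A)^[j + 1] x)
        ≤ (F.erase (x.seq 0)).card * (C + M) := by
      refine ih _ (by omega) _ _ fun k hk hkF => ?_
      rw [← Function.iterate_add_apply]
      rw [MShift.seq_iterate] at hkF
      refine hF _ (by omega) fun hmem => hkF (Finset.mem_erase.2 ⟨fun he => ?_, hmem⟩)
      have := hjmax (k + (j + 1)) ⟨by omega, he⟩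
      omega
    have hcard : (F.card : ℝ) = (F.erase (x.seq 0)).card + 1 := by
      exact_mod_cast (Finset.card_erase_add_one h0).symm
    have hsplit : n = j + 1 + (n - (j + 1)) := by omega
    rw [hsplit, birkhoff_add, birkhoff_add, birkhoff_one, hcard]
    linarith [hφM ((shiftMap A)^[j] x)]
  · have hsplit : n = 1 + (n - 1) := by omega
    have hrest := ih (n - 1) (by omega) F ((shiftMap A)^[1] x) fun k hk hkF => by
      rw [← Function.iterate_add_apply]
      rw [MShift.seq_iterate] at hkF
      exact hF _ (by omega) hkF
    rw [hsplit, birkhoff_add, birkhoff_one]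
    have := hF 0 hn h0
    simp only [Function.iterate_zero, id] at this
    linarith

theorem birkhoff_loop_le {V : ℕ → ℝ} (hVsum : Summable V)
    (hV : ∀ n : ℕ, 1 ≤ n → VarBdd A φ n (V n)) {β : ℝ}
    (hβ : ∀ (m : ℕ) (x : MShift A), 0 < m → (shiftMap A)^[m] x = x → birkhoff A φ m x ≤ m * β)
    {m : ℕ} {x : MShift A} (hm : 0 < m) (hx : x.seq m = x.seq 0) :
    birkhoff A φ m x ≤ m * β + ∑' n, |V n| := by
  have h1 := hβ m _ hm (MShift.iterate_closeUp x m hm hx)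
  have h2 := abs_birkhoff_sub_le hVsum hV (m := m) (x := x) (y := MShift.closeUp x m hm hx)
    fun i hi => (MShift.closeUp_seq_of_lt x m hm hx hi).symm
  linarith [(abs_le.1 h2).2]

end BirkhoffSums

section Summable

variable {A : ℕ → ℕ → Prop} {φ : MShift A → ℝ}

theorem SummablePot.finite_lt (h : SummablePot A φ) (c : ℝ) :
    ∃ F : Finset ℕ, ∀ x : MShift A, x.seq 0 ∉ F → φ x ≤ c := by
  obtain ⟨s, hs, hsφ⟩ := h
  have h0 := hs.tendsto_cofinite_zero.eventually (gt_mem_nhds (Real.exp_pos c))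
  rw [Filter.eventually_cofinite] at h0
  refine ⟨h0.toFinset, fun x hx => (hsφ _ x rfl).trans ?_⟩
  simp only [Set.Finite.mem_toFinset, Set.mem_ofPred_eq, not_not] at hx
  exact (Real.exp_lt_exp.1 hx).le

theorem SummablePot.bddAbove (h : SummablePot A φ) : ∃ M : ℝ, 0 ≤ M ∧ ∀ x, φ x ≤ M := by
  obtain ⟨s, hs, hsφ⟩ := h
  refine ⟨∑' i, Real.exp (s i), tsum_nonneg fun _ => (Real.exp_pos _).le, fun x => ?_⟩
  calc φ x ≤ s (x.seq 0) := hsφ _ x rfl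
    _ ≤ s (x.seq 0) + 1 := by linarith
    _ ≤ Real.exp (s (x.seq 0)) := Real.add_one_le_exp _
    _ ≤ _ := hs.le_tsum _ fun _ _ => (Real.exp_pos _).le

/-- A linear bound on periodic Birkhoff sums extends to all points, up to a constant. -/
theorem exists_birkhoff_le (hsum : SummablePot A φ) {V : ℕ → ℝ} (hVsum : Summable V)
    (hV : ∀ n : ℕ, 1 ≤ n → VarBdd A φ n (V n)) {β : ℝ}
    (hβ : ∀ (m : ℕ) (x : MShift A), 0 < m → (shiftMap A)^[m] x = x → birkhoff A φ m x ≤ m * β) :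
    ∃ K : ℝ, ∀ (n : ℕ) (x : MShift A), birkhoff A φ n x ≤ n * β + K := by
  obtain ⟨F, hF⟩ := hsum.finite_lt β
  obtain ⟨M, hM0, hM⟩ := hsum.bddAbove
  have hC : 0 ≤ ∑' n, |V n| := tsum_nonneg fun _ => abs_nonneg _
  refine ⟨F.card * ((∑' n, |V n|) + (M + |β|)), fun n x => ?_⟩
  have := birkhoff_le_card_mul (φ := fun x => φ x - β) hC (add_nonneg hM0 (abs_nonneg β))
    (fun x => by linarith [hM x, neg_abs_le β])
    (fun m x hm hx => by
      rw [birkhoff_sub_const]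
      linarith [birkhoff_loop_le hVsum hV hβ hm hx]) n F x
    (fun k _ hk => by
      have := hF ((shiftMap A)^[k] x) (by rwa [MShift.seq_iterate, zero_add])
      linarith)
  rw [birkhoff_sub_const] at this
  linarith

end Summable

section InvariantMeasures

variable {A : ℕ → ℕ → Prop} {φ : MShift A → ℝ}

theorem ShiftInv.measurePreserving {μ : Measure (MShift A)} (h : ShiftInv A μ) :
    MeasurePreserving (shiftMap A) μ μ :=
  ⟨MShift.continuous_shiftMap.measurable, Measure.ext fun s hs => by
    rw [Measure.map_apply MShift.continuous_shiftMap.measurable hs, h s hs]⟩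

theorem integral_birkhoff {μ : Measure (MShift A)} (h : ShiftInv A μ) (hφ : Integrable φ μ)
    (n : ℕ) : Integrable (birkhoff A φ n) μ ∧ ∫ x, birkhoff A φ n x ∂μ = n * ∫ x, φ x ∂μ := by
  have hpres (k : ℕ) : MeasurePreserving ((shiftMap A)^[k]) μ μ := h.measurePreserving.iterate k
  have hint (k : ℕ) : Integrable (fun x => φ ((shiftMap A)^[k] x)) μ :=
    (hpres k).integrable_comp_of_integrable hφ
  have heq (k : ℕ) : ∫ x, φ ((shiftMap A)^[k] x) ∂μ = ∫ x, φ x ∂μ := by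
    have h1 := integral_map (hpres k).measurable.aemeasurable (f := φ)
      (by rw [(hpres k).map_eq]; exact hφ.aestronglyMeasurable)
    rw [(hpres k).map_eq] at h1
    exact h1.symm
  refine ⟨integrable_finsetSum _ fun k _ => hint k, ?_⟩
  simp only [birkhoff]
  rw [integral_finsetSum _ fun k _ => hint k]
  simp [heq]

theorem integral_le_of_birkhoff_le {μ : Measure (MShift A)} [IsProbabilityMeasure μ]
    (h : ShiftInv A μ) (hφ : Integrable φ μ) {β K : ℝ}
    (hK : ∀ (n : ℕ) (x : MShift A), birkhoff A φ n x ≤ n * β + K) : ∫ x, φ x ∂μ ≤ β := by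
  have hn (n : ℕ) : n * (∫ x, φ x ∂μ - β) ≤ K := by
    obtain ⟨h1, h2⟩ := integral_birkhoff h hφ n
    have h3 := integral_mono h1 (integrable_const (n * β + K)) (hK n)
    rw [h2] at h3
    simp only [integral_const, probReal_univ, smul_eq_mul, one_mul] at h3
    linarith
  by_contra! hlt
  obtain ⟨n, hn'⟩ := exists_nat_gt (K / (∫ x, φ x ∂μ - β))
  rw [div_lt_iff₀ (sub_pos.2 hlt)] at hn'
  linarith [hn n]

/-- The uniform probability measure on a periodic orbit. -/
noncomputable def orbitMeasure (n : ℕ) (x : MShift A) : Measure (MShift A) :=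
  (n : ℝ≥0∞)⁻¹ • ∑ i ∈ Finset.range n, Measure.dirac ((shiftMap A)^[i] x)

theorem isProbabilityMeasure_orbitMeasure {n : ℕ} (hn : 0 < n) (x : MShift A) :
    IsProbabilityMeasure (orbitMeasure n x) := by
  refine ⟨?_⟩
  simp only [orbitMeasure, Measure.smul_apply, Measure.finsetSum_apply, measure_univ,
    Finset.sum_const, Finset.card_range, smul_eq_mul, nsmul_eq_mul, mul_one]
  exact ENNReal.inv_mul_cancel (by exact_mod_cast hn.ne') (ENNReal.natCast_ne_top n)

theorem shiftInv_orbitMeasure {n : ℕ} {x : MShift A} (hx : (shiftMap A)^[n] x = x) :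
    ShiftInv A (orbitMeasure n x) := by
  intro s hs
  simp only [orbitMeasure, Measure.smul_apply, Measure.finsetSum_apply]
  congr 1
  have h1 (i : ℕ) : Measure.dirac ((shiftMap A)^[i] x) (shiftMap A ⁻¹' s)
      = Measure.dirac ((shiftMap A)^[i + 1] x) s := by
    rw [Measure.dirac_apply' _ hs,
      Measure.dirac_apply' _ (MShift.continuous_shiftMap.measurable hs),
      Function.iterate_succ_apply']
    rfl
  simp only [h1]
  rcases n with _ | n
  · simp
  · rw [Finset.sum_range_succ, hx, Finset.sum_range_succ' _ n]
    simp

theorem integrable_orbitMeasure {n : ℕ} (hn : 0 < n) (φ : MShift A → ℝ) (x : MShift A) :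
    Integrable φ (orbitMeasure n x) := by
  refine Integrable.smul_measure ?_ (ENNReal.inv_ne_top.2 (by exact_mod_cast hn.ne'))
  rw [integrable_finsetSum_measure]
  exact fun i _ => integrable_dirac (by simp)

theorem integral_orbitMeasure (n : ℕ) (φ : MShift A → ℝ) (x : MShift A) :
    ∫ y, φ y ∂(orbitMeasure n x) = (n : ℝ)⁻¹ * birkhoff A φ n x := by
  rw [orbitMeasure, integral_smul_measure,
    integral_finsetSum_measure fun i _ => integrable_dirac (by simp)]
  simp [birkhoff]

theorem birkhoff_le_alphaSup (hsum : SummablePot A φ) {n : ℕ} (hn : 0 < n) {x : MShift A}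
    (hx : (shiftMap A)^[n] x = x) : birkhoff A φ n x ≤ n * alphaSup A φ := by
  obtain ⟨M, -, hM⟩ := hsum.bddAbove
  have hle : (n : ℝ)⁻¹ * birkhoff A φ n x ≤ alphaSup A φ := by
    refine le_csSup ⟨M, ?_⟩ ⟨orbitMeasure n x, isProbabilityMeasure_orbitMeasure hn x,
      shiftInv_orbitMeasure hx, integrable_orbitMeasure hn φ x, (integral_orbitMeasure n φ x).symm⟩
    rintro r ⟨μ, hμ, -, hint, rfl⟩
    simpa using integral_mono hint (integrable_const M) hM
  rwa [inv_mul_le_iff₀ (by exact_mod_cast hn)] at hle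

theorem TopTrans.exists_connecting (h : TopTrans A) (a b : ℕ) :
    ∃ (x : MShift A) (l : ℕ), 0 < l ∧ x.seq 0 = a ∧ x.seq l = b := by
  obtain ⟨w, ⟨hw, -, x, hx⟩, ha, hb⟩ := h a b
  refine ⟨x, w.length - 1, by omega, ?_, ?_⟩
  · rw [hx 0 (by omega), ← ha]
    cases w <;> simp
  · rw [hx _ (by omega), ← hb]
    rw [List.getD_eq_getElem?_getD, ← List.getLast?_eq_getElem?, List.getLastD_eq_getLast?]

theorem exists_periodic_gt (hTrans : TopTrans A) (hsum : SummablePot A φ) {V : ℕ → ℝ}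
    (hVsum : Summable V) (hV : ∀ n : ℕ, 1 ≤ n → VarBdd A φ n (V n)) {c : ℝ}
    (hc : c < alphaSup A φ) :
    ∃ (m : ℕ) (y : MShift A), 0 < m ∧ (shiftMap A)^[m] y = y ∧ m * c < birkhoff A φ m y := by
  by_contra! hcon
  obtain ⟨K, hK⟩ := exists_birkhoff_le hsum hVsum hV hcon
  refine hc.not_ge (csSup_le ?_ ?_)
  · obtain ⟨x, l, hl, h0, h1⟩ := hTrans.exists_connecting 0 0
    have hx := h1.trans h0.symm
    exact ⟨_, orbitMeasure l (x.closeUp l hl hx), isProbabilityMeasure_orbitMeasure hl _,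
      shiftInv_orbitMeasure (x.iterate_closeUp l hl hx), integrable_orbitMeasure hl φ _, rfl⟩
  · rintro r ⟨μ, hμ, hinv, hint, rfl⟩
    exact integral_le_of_birkhoff_le hinv hint hK

end InvariantMeasures

section Pressure

variable {A : ℕ → ℕ → Prop} {φ : MShift A → ℝ}

theorem log_ofReal_exp (r : ℝ) : ENNReal.log (ENNReal.ofReal (Real.exp r)) = (r : EReal) := by
  rw [ENNReal.log_ofReal_of_pos (Real.exp_pos r), Real.log_exp]

/-- Every periodic orbit is shadowed by loops at `a` running `k` times along it. -/
theorem exists_periodic_at (hTrans : TopTrans A) {V : ℕ → ℝ} (hVsum : Summable V)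
    (hV : ∀ n : ℕ, 1 ≤ n → VarBdd A φ n (V n)) (a : ℕ) {m : ℕ} {y : MShift A}
    (hy : (shiftMap A)^[m] y = y) :
    ∃ (L : ℕ) (K : ℝ), 0 < L ∧ ∀ k : ℕ, ∃ z : MShift A,
      (shiftMap A)^[m * k + L] z = z ∧ z.seq 0 = a ∧
        k * birkhoff A φ m y - K ≤ birkhoff A φ (m * k + L) z := by
  obtain ⟨p, l, hl, hp0, hpl⟩ := hTrans.exists_connecting a (y.seq 0)
  obtain ⟨q, l', hl', hq0, hql⟩ := hTrans.exists_connecting (y.seq 0) a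
  refine ⟨l + l', 3 * (∑' n, |V n|) - birkhoff A φ l p - birkhoff A φ l' q, by omega,
    fun k => ?_⟩
  have hyk : (shiftMap A)^[m * k] y = y := by
    rw [Function.iterate_mul]
    exact Function.iterate_fixed hy k
  have hyq : y.seq (m * k) = q.seq 0 := by
    have := MShift.seq_iterate (m * k) y 0
    rw [hyk, zero_add] at this
    rw [hq0, this]
  have hu0 : (y.concat (m * k) q hyq).seq 0 = y.seq 0 := by
    rcases Nat.eq_zero_or_pos (m * k) with h | h
    · simp [MShift.concat, h, hq0]
    · exact MShift.concat_seq_of_lt hyq h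
  set u := y.concat (m * k) q hyq with hu
  have hpu : p.seq l = u.seq 0 := by rw [hpl, hu0]
  set v := p.concat l u hpu with hv
  have hv1 : (shiftMap A)^[l] v = u := MShift.iterate_concat hpu
  have hu1 : (shiftMap A)^[m * k] u = q := MShift.iterate_concat hyq
  have hN : m * k + (l + l') = l + (m * k + l') := by omega
  have hv0 : v.seq 0 = a := by rw [hv, MShift.concat_seq_of_lt hpu hl, hp0]
  have hvN : v.seq (l + (m * k + l')) = v.seq 0 := by
    have h1 := MShift.seq_iterate l v (m * k + l')
    have h2 := MShift.seq_iterate (m * k) u l'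
    rw [hv1] at h1
    rw [hu1] at h2
    rw [hv0, ← hql, h2, add_comm l' (m * k), h1, add_comm l]
  have hNpos : 0 < l + (m * k + l') := by omega
  rw [hN]
  refine ⟨v.closeUp _ hNpos hvN, MShift.iterate_closeUp _ _ _ _, ?_, ?_⟩
  · rw [MShift.closeUp_seq_of_lt _ _ _ _ hNpos, hv0]
  · have e1 := abs_birkhoff_sub_le hVsum hV (x := v.closeUp _ hNpos hvN) (y := v)
      fun i hi => MShift.closeUp_seq_of_lt v _ hNpos hvN hi
    have e2 := abs_birkhoff_sub_le hVsum hV (x := v) (y := p)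
      fun i hi => MShift.concat_seq_of_lt hpu hi
    have e3 := abs_birkhoff_sub_le hVsum hV (x := u) (y := y)
      fun i hi => MShift.concat_seq_of_lt hyq hi
    have hs : birkhoff A φ (l + (m * k + l')) v
        = birkhoff A φ l v + (birkhoff A φ (m * k) u + birkhoff A φ l' q) := by
      rw [birkhoff_add, hv1, birkhoff_add, hu1]
    rw [birkhoff_mul_of_periodic hy] at e3
    linarith [(abs_le.1 e1).1, (abs_le.1 e2).1, (abs_le.1 e3).1]

theorem le_PGur_of_lt_alphaSup (hTrans : TopTrans A) (hsum : SummablePot A φ) {V : ℕ → ℝ}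
    (hVsum : Summable V) (hV : ∀ n : ℕ, 1 ≤ n → VarBdd A φ n (V n)) (a : ℕ) {t : ℝ} (ht : 0 < t)
    {c : ℝ} (hc : c < alphaSup A φ) :
    ((t * c : ℝ) : EReal) ≤ PGur A (fun x => t * φ x) a := by
  obtain ⟨m, y, hm, hy, hgt⟩ := exists_periodic_gt hTrans hsum hVsum hV hc
  obtain ⟨L, K, hL, hz⟩ := exists_periodic_at hTrans hVsum hV a hy
  have hklarge : ∀ᶠ k : ℕ in atTop, (K + L * c) / (birkhoff A φ m y - m * c) ≤ k :=
    (tendsto_natCast_atTop_atTop (R := ℝ)).eventually_ge_atTop _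
  have htend : Tendsto (fun k : ℕ => m * k + L) atTop atTop :=
    tendsto_atTop_mono
      (fun k => (Nat.le_mul_of_pos_left k hm).trans (Nat.le_add_right _ _)) tendsto_id
  refine le_limsup_of_frequently_le (htend.frequently (Eventually.frequently ?_))
  filter_upwards [hklarge] with k hk
  obtain ⟨z, hzp, hza, hzS⟩ := hz k
  rw [div_le_iff₀ (sub_pos.2 hgt)] at hk
  have hNpos : (0 : ℝ) < ((m * k + L : ℕ) : ℝ) := by exact_mod_cast (by omega : 0 < m * k + L)
  have hZ : ENNReal.ofReal (Real.exp (t * birkhoff A φ (m * k + L) z))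
      ≤ Zpart A (fun x => t * φ x) (m * k + L) a := by
    rw [← birkhoff_const_mul]
    exact ENNReal.le_tsum (f := fun x : {x : MShift A //
      (shiftMap A)^[m * k + L] x = x ∧ x.seq 0 = a} => ENNReal.ofReal
        (Real.exp (birkhoff A (fun x => t * φ x) (m * k + L) x.1))) ⟨z, hzp, hza⟩
  have hlog := ENNReal.log_monotone hZ
  rw [log_ofReal_exp] at hlog
  calc ((t * c : ℝ) : EReal)
      ≤ ((((m * k + L : ℕ) : ℝ)⁻¹ * (t * birkhoff A φ (m * k + L) z) : ℝ) : EReal) := by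
        rw [EReal.coe_le_coe_iff, le_inv_mul_iff₀ hNpos]
        have : ((m * k + L : ℕ) : ℝ) * c ≤ birkhoff A φ (m * k + L) z := by
          push_cast
          linarith
        nlinarith
    _ = ((((m * k + L : ℕ) : ℝ)⁻¹ : ℝ) : EReal) * ((t * birkhoff A φ (m * k + L) z : ℝ) : EReal) :=
        EReal.coe_mul _ _
    _ ≤ _ := mul_le_mul_of_nonneg_left hlog (EReal.coe_nonneg.2 (inv_nonneg.2 hNpos.le))

theorem mul_alphaSup_le_PGur (hTrans : TopTrans A) (hsum : SummablePot A φ) {V : ℕ → ℝ}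
    (hVsum : Summable V) (hV : ∀ n : ℕ, 1 ≤ n → VarBdd A φ n (V n)) (a : ℕ) {t : ℝ} (ht : 0 < t) :
    ((t * alphaSup A φ : ℝ) : EReal) ≤ PGur A (fun x => t * φ x) a := by
  refine EReal.ge_of_forall_gt_iff_ge.1 fun r hr => ?_
  have hc : r / t < alphaSup A φ := by
    rw [div_lt_iff₀ ht, mul_comm]
    exact_mod_cast hr
  have := le_PGur_of_lt_alphaSup hTrans hsum hVsum hV a ht hc
  rwa [mul_div_cancel₀ _ ht.ne'] at this

theorem Zpart_mul_le (hsum : SummablePot A φ) (a : ℕ) {t : ℝ} (ht : 1 ≤ t) {n : ℕ} (hn : 0 < n) :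
    Zpart A (fun x => t * φ x) n a
      ≤ ENNReal.ofReal (Real.exp (n * ((t - 1) * alphaSup A φ))) * Zpart A φ n a := by
  unfold Zpart
  rw [← ENNReal.tsum_mul_left]
  refine ENNReal.tsum_le_tsum fun x => ?_
  rw [← ENNReal.ofReal_mul (Real.exp_pos _).le, ← Real.exp_add, birkhoff_const_mul]
  refine ENNReal.ofReal_le_ofReal (Real.exp_le_exp.2 ?_)
  nlinarith [birkhoff_le_alphaSup hsum hn x.2.1, sub_nonneg.2 ht]

theorem PGur_mul_le (hsum : SummablePot A φ) (a : ℕ) {t : ℝ} (ht : 1 ≤ t) {p : ℝ}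
    (hp : PGur A φ a < p) :
    PGur A (fun x => t * φ x) a ≤ (((t - 1) * alphaSup A φ + p : ℝ) : EReal) := by
  refine limsup_le_of_le (h := ?_)
  filter_upwards [eventually_lt_of_limsup_lt hp, eventually_gt_atTop 0] with n hnp hn
  have hn' : (0 : ℝ) < n := by exact_mod_cast hn
  have hlog := ENNReal.log_monotone (Zpart_mul_le hsum a ht hn)
  rw [ENNReal.log_mul_add, log_ofReal_exp] at hlog
  have hinv : (0 : EReal) ≤ (((n : ℝ)⁻¹ : ℝ) : EReal) := EReal.coe_nonneg.2 (inv_nonneg.2 hn'.le)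
  calc (((n : ℝ)⁻¹ : ℝ) : EReal) * ENNReal.log (Zpart A (fun x => t * φ x) n a)
      ≤ (((n : ℝ)⁻¹ : ℝ) : EReal) * (((n * ((t - 1) * alphaSup A φ) : ℝ) : EReal)
          + ENNReal.log (Zpart A φ n a)) := mul_le_mul_of_nonneg_left hlog hinv
    _ = (((t - 1) * alphaSup A φ : ℝ) : EReal)
          + (((n : ℝ)⁻¹ : ℝ) : EReal) * ENNReal.log (Zpart A φ n a) := by
        rw [EReal.left_distrib_of_nonneg_of_ne_top hinv (EReal.coe_ne_top _), ← EReal.coe_mul,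
          inv_mul_cancel_left₀ hn'.ne']
    _ ≤ _ := by
        rw [EReal.coe_add]
        gcongr

end Pressure

/-- `lim_{t→∞} P_G(tφ)/t = α(φ)` for a summable potential with summable
variations and finite Gurevich pressure on a topologically transitive countable Markov
shift. -/
theorem stmt1 (A : ℕ → ℕ → Prop) (hA : NoZeroRC A) (hTrans : TopTrans A)
    (φ : MShift A → ℝ) (hsum : SummablePot A φ)
    (V : ℕ → ℝ) (hVsum : Summable V) (hV : ∀ n : ℕ, 1 ≤ n → VarBdd A φ n (V n))
    (hfin : ∀ a : ℕ, PGur A φ a < ⊤) :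
    ∀ a : ℕ, Tendsto (fun t : ℝ => (((t⁻¹ : ℝ)) : EReal) * PGur A (fun x => t * φ x) a)
      atTop (𝓝 ((alphaSup A φ : ℝ) : EReal)) := by
  intro a
  obtain ⟨p, hp, -⟩ := EReal.lt_iff_exists_real_btwn.1 (hfin a)
  have hlim : Tendsto (fun t : ℝ => t⁻¹ * ((t - 1) * alphaSup A φ + p)) atTop
      (𝓝 (alphaSup A φ)) := by
    have h1 : Tendsto (fun t : ℝ => alphaSup A φ + t⁻¹ * (p - alphaSup A φ)) atTop
        (𝓝 (alphaSup A φ + 0 * (p - alphaSup A φ))) :=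
      tendsto_const_nhds.add (tendsto_inv_atTop_zero.mul_const _)
    rw [zero_mul, add_zero] at h1
    refine h1.congr' ?_
    filter_upwards [eventually_gt_atTop 0] with t ht
    field_simp
    ring
  refine tendsto_of_tendsto_of_tendsto_of_le_of_le' tendsto_const_nhds
    ((continuous_coe_real_ereal.tendsto _).comp hlim) ?_ ?_
  · filter_upwards [eventually_gt_atTop 0] with t ht
    have h := mul_le_mul_of_nonneg_left (mul_alphaSup_le_PGur hTrans hsum hVsum hV a ht)
      (EReal.coe_nonneg.2 (inv_nonneg.2 ht.le))
    rwa [← EReal.coe_mul, inv_mul_cancel_left₀ ht.ne'] at h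
  · filter_upwards [eventually_ge_atTop 1] with t ht
    have h := mul_le_mul_of_nonneg_left (PGur_mul_le hsum a ht hp)
      (EReal.coe_nonneg.2 (inv_nonneg.2 (zero_le_one.trans ht)))
    rwa [← EReal.coe_mul] at h
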